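/- arXiv:2502.10960 — 3 statements merged into one kernel-verified Lean document; each statement's English description precedes it below -/
import Mathlib

section
/- For every δ > 0, lim_{b→∞} P( min_{0 ≤ j ≤ ⌊b^{2−δ}⌋} S_j > b/2 | S₀ = b ) = 1, where (S_j)_{j≥0} is the edge-local-time Markov chain defined in the context. -/
open MeasureTheory Filter ProbabilityTheory

noncomputable section

/-- One-step transition probability of the urn discrepancy chain with parameter `lam`:
from state `i`, jump to `i+1` with probability `lam^(2i-1)/(1+lam^(2i-1))` and to `i-1`
with probability `1/(1+lam^(2i-1))`. -/
def urnStep (lam : ℝ) (i j : ℤ) : ℝ :=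
  if j = i + 1 then lam ^ (2 * i - 1) / (1 + lam ^ (2 * i - 1))
  else if j = i - 1 then 1 / (1 + lam ^ (2 * i - 1))
  else 0

/-- `P` is the family of laws (indexed by the starting point) of the urn discrepancy
chain with parameter `lam`, characterized by its cylinder probabilities. -/
def IsUrnChain (lam : ℝ) (P : ℤ → Measure (ℕ → ℤ)) : Prop :=
  (∀ x, IsProbabilityMeasure (P x)) ∧
    ∀ (x : ℤ) (n : ℕ) (p : ℕ → ℤ),
      (P x {ω | ∀ i ≤ n, ω i = p i}).toReal =
        (if p 0 = x then (1 : ℝ) else 0) *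
          ∏ i ∈ Finset.range n, urnStep lam (p i) (p (i + 1))

/-- Number of down-steps of the path `ω` during the time interval `[1, j]`. -/
def downCount (ω : ℕ → ℤ) (j : ℕ) : ℕ :=
  ((Finset.Icc 1 j).filter fun ℓ => ω ℓ = ω (ℓ - 1) - 1).card

/-- `betaTime ω i` is the time of the `i`-th down-step of the path `ω`. -/
def betaTime (ω : ℕ → ℤ) (i : ℕ) : ℕ :=
  sInf {j | 1 ≤ j ∧ downCount ω j = i}

/-- The probability distribution `π(x) = lam^(x²) / Σ_y lam^(y²)` on `ℤ`. -/
def urnPi (lam : ℝ) (x : ℤ) : ℝ :=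
  lam ^ (x ^ 2) / ∑' y : ℤ, lam ^ (y ^ 2)

/-- `Q` is the family of laws (indexed by the starting point) of the edge-local-time chain:
the Markov chain on `ℕ` whose step distribution from state `i` is that of
`𝔇_{β_{i+1}}` under `P₁`. -/
def IsEdgeChain (lam : ℝ) (P : ℤ → Measure (ℕ → ℤ)) (Q : ℕ → Measure (ℕ → ℕ)) : Prop :=
  (∀ b, IsProbabilityMeasure (Q b)) ∧
    ∀ (b : ℕ) (n : ℕ) (p : ℕ → ℕ),
      (Q b {ω | ∀ i ≤ n, ω i = p i}).toReal =
        (if p 0 = b then (1 : ℝ) else 0) *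
          ∏ i ∈ Finset.range n,
            (P 1 {ω | ω (betaTime ω (p i + 1)) = (p (i + 1) : ℤ) - (p i : ℤ)}).toReal

lemma summable_pow_mul_gauss {lam : ℝ} (hlam : lam ∈ Set.Ioo (0 : ℝ) 1) (m : ℕ) :
    Summable fun x : ℤ => |(x : ℝ)| ^ m * lam ^ (x ^ 2) := by
  obtain ⟨h0, h1⟩ := hlam
  have hnat : Summable fun n : ℕ => (n : ℝ) ^ m * lam ^ n :=
    summable_pow_mul_geometric_of_norm_lt_one m (by rwa [Real.norm_of_nonneg h0.le])
  have hsq : Summable fun n : ℕ => (n : ℝ) ^ m * lam ^ (n ^ 2) :=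
    hnat.of_nonneg_of_le (fun n => by positivity) fun n => by
      have : lam ^ (n ^ 2) ≤ lam ^ n :=
        pow_le_pow_of_le_one h0.le h1.le (Nat.le_self_pow two_ne_zero n)
      gcongr
  have hcast (n : ℕ) : lam ^ ((n : ℤ) ^ 2) = lam ^ (n ^ 2) := by
    exact_mod_cast zpow_natCast lam (n ^ 2)
  refine Summable.of_nat_of_neg (hsq.congr fun n => ?_) (hsq.congr fun n => ?_)
  · simp [hcast]
  · simp [hcast]

lemma summable_gauss {lam : ℝ} (hlam : lam ∈ Set.Ioo (0 : ℝ) 1) :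
    Summable fun x : ℤ => lam ^ (x ^ 2) := by
  simpa using summable_pow_mul_gauss hlam 0

/-- The tail sum `∑_{y ≥ x} lam ^ (y²)`. -/
def gaussTail (lam : ℝ) (x : ℤ) : ℝ := ∑' j : ℕ, lam ^ ((x + j) ^ 2)

lemma summable_gauss_shift {lam : ℝ} (hlam : lam ∈ Set.Ioo (0 : ℝ) 1) (x : ℤ) :
    Summable fun j : ℕ => lam ^ ((x + j) ^ 2) :=
  (summable_gauss hlam).comp_injective (i := fun j : ℕ => x + j) fun a b h => by simpa using h

lemma gaussTail_eq_add {lam : ℝ} (hlam : lam ∈ Set.Ioo (0 : ℝ) 1) (x : ℤ) :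
    gaussTail lam x = lam ^ (x ^ 2) + gaussTail lam (x + 1) := by
  unfold gaussTail
  rw [(summable_gauss_shift hlam x).tsum_eq_zero_add]
  simp [add_assoc, add_comm (1 : ℤ)]

lemma gaussTail_add_gaussTail {lam : ℝ} (hlam : lam ∈ Set.Ioo (0 : ℝ) 1) (x : ℤ) :
    gaussTail lam x + gaussTail lam (1 - x) = gaussTail lam 0 + gaussTail lam 1 := by
  have step (x : ℤ) : gaussTail lam (x + 1) + gaussTail lam (1 - (x + 1)) =
      gaussTail lam x + gaussTail lam (1 - x) := by
    have h1 := gaussTail_eq_add hlam x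
    have h2 := gaussTail_eq_add hlam (-x)
    rw [show 1 - (x + 1) = -x by ring, h1, h2, show -x + 1 = 1 - x by ring, neg_sq]
    ring
  induction x using Int.induction_on with
  | zero => simp
  | succ n ih => rw [step, ih]
  | pred n ih => rw [← ih, ← step (-(n : ℤ) - 1), sub_add_cancel]

lemma gaussTail_nonneg {lam : ℝ} (hlam : lam ∈ Set.Ioo (0 : ℝ) 1) (x : ℤ) :
    0 ≤ gaussTail lam x :=
  tsum_nonneg fun _ => zpow_nonneg hlam.1.le _

lemma one_le_gaussTail_zero {lam : ℝ} (hlam : lam ∈ Set.Ioo (0 : ℝ) 1) :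
    1 ≤ gaussTail lam 0 := by
  rw [gaussTail_eq_add hlam]
  simpa using gaussTail_nonneg hlam 1

lemma gaussTail_natCast_le {lam : ℝ} (hlam : lam ∈ Set.Ioo (0 : ℝ) 1) (m : ℕ) :
    gaussTail lam m ≤ lam ^ ((m : ℤ) ^ 2) * gaussTail lam 0 := by
  unfold gaussTail
  rw [← tsum_mul_left]
  refine (summable_gauss_shift hlam m).tsum_le_tsum (fun j => ?_)
    ((summable_gauss_shift hlam 0).mul_left _)
  rw [← zpow_add₀ hlam.1.ne']
  refine zpow_le_zpow_right_of_le_one₀ hlam.1 hlam.2.le ?_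
  have : (0 : ℤ) ≤ m * j := by positivity
  linarith [show ((m : ℤ) + j) ^ 2 = m ^ 2 + (0 + j) ^ 2 + 2 * (m * j) by ring]

/-- The total mass `∑_y lam ^ (y²)`. -/
def gaussMass (lam : ℝ) : ℝ := gaussTail lam 0 + gaussTail lam 1

lemma one_le_gaussMass {lam : ℝ} (hlam : lam ∈ Set.Ioo (0 : ℝ) 1) : 1 ≤ gaussMass lam :=
  (one_le_gaussTail_zero hlam).trans (le_add_of_nonneg_right (gaussTail_nonneg hlam 1))

/-- The tail of the normalized weights `lam ^ (x²) / ∑_y lam ^ (y²)`. -/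
def normTail (lam : ℝ) (x : ℤ) : ℝ := gaussTail lam x / gaussMass lam

lemma normTail_sub {lam : ℝ} (hlam : lam ∈ Set.Ioo (0 : ℝ) 1) (x : ℤ) :
    normTail lam x - normTail lam (x + 1) = lam ^ (x ^ 2) / gaussMass lam := by
  rw [normTail, normTail, gaussTail_eq_add hlam x]
  ring

lemma normTail_add_normTail {lam : ℝ} (hlam : lam ∈ Set.Ioo (0 : ℝ) 1) (x : ℤ) :
    normTail lam x + normTail lam (1 - x) = 1 := by
  have := one_le_gaussMass hlam
  rw [normTail, normTail, ← add_div, gaussTail_add_gaussTail hlam]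
  exact div_self (by unfold gaussMass at this; linarith)

lemma normTail_nonneg {lam : ℝ} (hlam : lam ∈ Set.Ioo (0 : ℝ) 1) (x : ℤ) :
    0 ≤ normTail lam x :=
  div_nonneg (gaussTail_nonneg hlam x) (zero_le_one.trans (one_le_gaussMass hlam))

lemma normTail_natCast_le {lam : ℝ} (hlam : lam ∈ Set.Ioo (0 : ℝ) 1) (m : ℕ) :
    normTail lam m ≤ lam ^ ((m : ℤ) ^ 2) := by
  have := one_le_gaussMass hlam
  rw [normTail, div_le_iff₀ (by linarith)]
  refine (gaussTail_natCast_le hlam m).trans ?_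
  have h0 := hlam.1
  have : gaussTail lam 0 ≤ gaussMass lam := le_add_of_nonneg_right (gaussTail_nonneg hlam 1)
  gcongr

/-- The probability that `k` up-steps of the urn discrepancy chain started at `1` occur
before `N` down-steps. -/
def upsFirst (lam : ℝ) : ℕ → ℕ → ℝ
  | _, 0 => 1
  | 0, _ + 1 => 0
  | N + 1, k + 1 =>
    (lam ^ (2 * k + 1) * upsFirst lam (N + 1) k + lam ^ (2 * N) * upsFirst lam N (k + 1)) /
      (lam ^ (2 * N) + lam ^ (2 * k + 1))

lemma upsFirst_zero_right (lam : ℝ) (N : ℕ) : upsFirst lam N 0 = 1 := by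
  rw [upsFirst]

lemma upsFirst_zero_succ (lam : ℝ) (k : ℕ) : upsFirst lam 0 (k + 1) = 0 := by
  rw [upsFirst]

lemma upsFirst_succ_succ {lam : ℝ} (hlam : lam ∈ Set.Ioo (0 : ℝ) 1) (N k : ℕ) :
    upsFirst lam (N + 1) (k + 1) * (lam ^ (2 * N) + lam ^ (2 * k + 1)) =
      lam ^ (2 * k + 1) * upsFirst lam (N + 1) k + lam ^ (2 * N) * upsFirst lam N (k + 1) := by
  have h0 := hlam.1
  rw [upsFirst]
  field_simp

lemma normTail_rec {lam : ℝ} (hlam : lam ∈ Set.Ioo (0 : ℝ) 1) (N k : ℕ) :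
    normTail lam (k - N + 1) * (lam ^ (2 * N) + lam ^ (2 * k + 1)) =
      lam ^ (2 * k + 1) * normTail lam (k - N) + lam ^ (2 * N) * normTail lam (k - N + 1 + 1) := by
  have h1 := normTail_sub hlam (k - N)
  have h2 := normTail_sub hlam (k - N + 1)
  have h3 : lam ^ (2 * N) * lam ^ (((k : ℤ) - N + 1) ^ 2) =
      lam ^ (2 * k + 1) * lam ^ (((k : ℤ) - N) ^ 2) := by
    rw [← zpow_natCast, ← zpow_natCast, ← zpow_add₀ hlam.1.ne', ← zpow_add₀ hlam.1.ne']
    congr 1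
    push_cast
    ring
  have h4 : lam ^ (2 * N) * (normTail lam (k - N + 1) - normTail lam (k - N + 1 + 1)) =
      lam ^ (2 * k + 1) * (normTail lam (k - N) - normTail lam (k - N + 1)) := by
    rw [h1, h2, ← mul_div_assoc, ← mul_div_assoc, h3]
  linarith

lemma abs_upsFirst_sub_normTail_le {lam : ℝ} (hlam : lam ∈ Set.Ioo (0 : ℝ) 1) (N k : ℕ) :
    |upsFirst lam N k - normTail lam (k - N + 1)| ≤ lam ^ (((k : ℤ) - N) ^ 2 + 2 * k) := by
  have h0 := hlam.1
  induction N generalizing k with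
  | zero =>
    cases k with
    | zero =>
      rw [upsFirst_zero_right]
      have h1 := normTail_nonneg hlam 0
      have h2 := normTail_nonneg hlam 1
      have h3 := normTail_add_normTail hlam 0
      rw [sub_zero] at h3
      simp only [Nat.cast_zero, sub_zero, zero_add, mul_zero, add_zero, ne_eq, OfNat.ofNat_ne_zero,
        not_false_eq_true, zero_pow, zpow_zero]
      rw [abs_le]
      constructor <;> linarith
    | succ k =>
      rw [upsFirst_zero_succ, zero_sub, abs_neg, abs_of_nonneg (normTail_nonneg hlam _)]
      have := normTail_natCast_le hlam (k + 2)
      push_cast at this ⊢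
      rw [show (k : ℤ) + 1 - 0 + 1 = k + 2 by ring]
      refine this.trans (zpow_le_zpow_right_of_le_one₀ h0 hlam.2.le ?_)
      linarith [show ((k : ℤ) + 2) ^ 2 = (k + 1 - 0) ^ 2 + 2 * (k + 1) + 1 by ring]
  | succ N ihN =>
    induction k with
    | zero =>
      rw [upsFirst_zero_right]
      have h3 := normTail_add_normTail hlam (-N)
      have h4 := normTail_natCast_le hlam (N + 1)
      have h5 := normTail_nonneg hlam (1 - -N)
      push_cast at h4 ⊢
      rw [show (0 : ℤ) - (N + 1) + 1 = -N by ring, ← h3, add_sub_cancel_left, abs_of_nonneg h5,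
        show (1 : ℤ) - -N = N + 1 by ring]
      convert h4 using 2
      ring
    | succ k ihk =>
      have hA := upsFirst_succ_succ hlam N k
      have hP := normTail_rec hlam N k
      have hN := ihN (k + 1)
      push_cast at hN ihk ⊢
      rw [show (k : ℤ) + 1 - N + 1 = k - N + 1 + 1 by ring] at hN
      rw [show (k : ℤ) - (N + 1) + 1 = k - N by ring] at ihk
      rw [show (k : ℤ) + 1 - (N + 1) + 1 = k - N + 1 by ring]
      set a := upsFirst lam (N + 1) (k + 1)
      set D := lam ^ (2 * N) + lam ^ (2 * k + 1) with hD
      have hDpos : 0 < D := by positivity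
      have e1 : lam ^ (2 * k + 1) * lam ^ (((k : ℤ) - (N + 1)) ^ 2 + 2 * k) =
          lam ^ (((k : ℤ) + 1 - (N + 1)) ^ 2 + 2 * (k + 1)) * lam ^ (2 * N) := by
        rw [← zpow_natCast, ← zpow_natCast, ← zpow_add₀ h0.ne', ← zpow_add₀ h0.ne']
        congr 1
        push_cast
        ring
      have e2 : lam ^ (2 * N) * lam ^ (((k : ℤ) + 1 - N) ^ 2 + 2 * (k + 1)) =
          lam ^ (((k : ℤ) + 1 - (N + 1)) ^ 2 + 2 * (k + 1)) * lam ^ (2 * k + 1) := by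
        rw [← zpow_natCast, ← zpow_natCast, ← zpow_add₀ h0.ne', ← zpow_add₀ h0.ne']
        congr 1
        push_cast
        ring
      have key : (a - normTail lam (k - N + 1)) * D =
          lam ^ (2 * k + 1) * (upsFirst lam (N + 1) k - normTail lam (k - N)) +
          lam ^ (2 * N) * (upsFirst lam N (k + 1) - normTail lam (k - N + 1 + 1)) := by
        linarith
      refine le_of_mul_le_mul_right ?_ hDpos
      rw [← abs_of_pos hDpos, ← abs_mul, key, abs_of_pos hDpos]
      refine (abs_add_le _ _).trans ?_
      rw [abs_mul, abs_mul, abs_of_pos (by positivity : 0 < lam ^ (2 * k + 1)),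
        abs_of_pos (by positivity : 0 < lam ^ (2 * N)), hD, mul_add, ← e1, ← e2]
      gcongr

/-- The transition probability of the edge-local-time chain from `n` to `k`. -/
def edgeStep (lam : ℝ) (n k : ℕ) : ℝ := upsFirst lam (n + 1) k - upsFirst lam (n + 1) (k + 1)

lemma abs_edgeStep_sub_le {lam : ℝ} (hlam : lam ∈ Set.Ioo (0 : ℝ) 1) (n k : ℕ) :
    |edgeStep lam n k - lam ^ (((k : ℤ) - n) ^ 2) / gaussMass lam| ≤
      lam ^ (2 * n) * (lam ^ (((k : ℤ) - n) ^ 2) + lam ^ (((k : ℤ) - n + 1) ^ 2)) := by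
  have h0 := hlam.1
  have h1 := abs_upsFirst_sub_normTail_le hlam (n + 1) k
  have h2 := abs_upsFirst_sub_normTail_le hlam (n + 1) (k + 1)
  have h3 := normTail_sub hlam (k - n)
  push_cast at h1 h2
  rw [show (k : ℤ) - (n + 1) + 1 = k - n by ring] at h1
  rw [show (k : ℤ) + 1 - (n + 1) + 1 = k - n + 1 by ring] at h2
  rw [edgeStep, ← h3]
  have e1 : lam ^ (((k : ℤ) - (n + 1)) ^ 2 + 2 * k) ≤ lam ^ (2 * n) * lam ^ (((k : ℤ) - n) ^ 2) := by
    rw [← zpow_natCast, ← zpow_add₀ h0.ne']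
    refine zpow_le_zpow_right_of_le_one₀ h0 hlam.2.le ?_
    push_cast
    linarith [show ((k : ℤ) - (n + 1)) ^ 2 + 2 * k = 2 * n + (k - n) ^ 2 + 1 by ring]
  have e2 : lam ^ (((k : ℤ) + 1 - (n + 1)) ^ 2 + 2 * (k + 1)) ≤
      lam ^ (2 * n) * lam ^ (((k : ℤ) - n + 1) ^ 2) := by
    rw [← zpow_natCast, ← zpow_add₀ h0.ne']
    refine zpow_le_zpow_right_of_le_one₀ h0 hlam.2.le ?_
    push_cast
    linarith [show ((k : ℤ) + 1 - (n + 1)) ^ 2 + 2 * (k + 1) = 2 * n + (k - n + 1) ^ 2 + 1 by ring]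
  rw [abs_le] at *
  constructor <;> linarith

lemma tendsto_upsFirst {lam : ℝ} (hlam : lam ∈ Set.Ioo (0 : ℝ) 1) (N : ℕ) :
    Tendsto (upsFirst lam N) atTop (nhds 0) := by
  have h0 := hlam.1
  rw [← tendsto_add_atTop_iff_nat N]
  have hlim : Tendsto (fun m : ℕ => 2 * lam ^ m) atTop (nhds 0) := by
    simpa using (tendsto_pow_atTop_nhds_zero_of_lt_one h0.le hlam.2).const_mul 2
  refine squeeze_zero_norm (fun m => ?_) hlim
  have h1 := abs_upsFirst_sub_normTail_le hlam N (m + N)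
  have h2 := normTail_natCast_le hlam (m + 1)
  have h3 := normTail_nonneg hlam (m + 1)
  push_cast at h1 h2
  rw [show (m : ℤ) + N - N = m by ring] at h1
  have e1 : lam ^ ((m : ℤ) ^ 2 + 2 * (m + N)) ≤ lam ^ m := by
    rw [← zpow_natCast]
    exact zpow_le_zpow_right_of_le_one₀ h0 hlam.2.le (by nlinarith)
  have e2 : lam ^ (((m : ℤ) + 1) ^ 2) ≤ lam ^ m := by
    rw [← zpow_natCast]
    exact zpow_le_zpow_right_of_le_one₀ h0 hlam.2.le (by nlinarith)
  rw [Real.norm_eq_abs]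
  rw [abs_le] at *
  constructor <;> linarith

/-- A summable function on `ℤ` dominating the moments of order at most two of the edge chain
increments. -/
def stepBound (lam : ℝ) (x : ℤ) : ℝ :=
  (1 + (x : ℝ) ^ 2) * (lam ^ (x ^ 2) + lam ^ ((x + 1) ^ 2))

lemma stepBound_nonneg {lam : ℝ} (hlam : lam ∈ Set.Ioo (0 : ℝ) 1) (x : ℤ) :
    0 ≤ stepBound lam x := by
  have h0 := hlam.1
  unfold stepBound
  positivity

lemma summable_stepBound {lam : ℝ} (hlam : lam ∈ Set.Ioo (0 : ℝ) 1) :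
    Summable (stepBound lam) := by
  have h0 := hlam.1
  have hs : Summable fun x : ℤ => (3 + 2 * (x : ℝ) ^ 2) * lam ^ (x ^ 2) := by
    refine (((summable_gauss hlam).mul_left 3).add
      ((summable_pow_mul_gauss hlam 2).mul_left 2)).congr fun x => ?_
    rw [sq_abs]
    ring
  refine (hs.add (hs.comp_injective (add_left_injective (1 : ℤ)))).of_nonneg_of_le
    (stepBound_nonneg hlam) fun x => ?_
  rw [stepBound, mul_add]
  simp only [Function.comp_apply]
  push_cast
  refine add_le_add (mul_le_mul_of_nonneg_right ?_ (by positivity))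
    (mul_le_mul_of_nonneg_right ?_ (by positivity)) <;> nlinarith [sq_nonneg ((x : ℝ) + 2)]

lemma summable_stepBound_sub {lam : ℝ} (hlam : lam ∈ Set.Ioo (0 : ℝ) 1) (n : ℕ) :
    Summable fun k : ℕ => stepBound lam (k - n) :=
  (summable_stepBound hlam).comp_injective (i := fun k : ℕ => (k : ℤ) - n)
    fun a b h => by simpa using h

lemma tsum_stepBound_sub_le {lam : ℝ} (hlam : lam ∈ Set.Ioo (0 : ℝ) 1) (n : ℕ) :
    ∑' k : ℕ, stepBound lam (k - n) ≤ ∑' x, stepBound lam x :=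
  tsum_comp_le_tsum_of_inj (summable_stepBound hlam) (stepBound_nonneg hlam)
    (i := fun k : ℕ => (k : ℤ) - n) fun a b h => by simpa using h

lemma abs_le_one_add_sq (x : ℝ) : |x| ≤ 1 + x ^ 2 := by
  rw [abs_le]
  constructor <;> nlinarith [sq_nonneg (x + 1), sq_nonneg (x - 1)]

lemma abs_edgeStep_le {lam : ℝ} (hlam : lam ∈ Set.Ioo (0 : ℝ) 1) (n k : ℕ) :
    |edgeStep lam n k| ≤ 2 * (lam ^ (((k : ℤ) - n) ^ 2) + lam ^ (((k : ℤ) - n + 1) ^ 2)) := by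
  have h0 := hlam.1
  have h1 := abs_edgeStep_sub_le hlam n k
  have hZ := one_le_gaussMass hlam
  set u := lam ^ (((k : ℤ) - n) ^ 2) with hu
  set v := lam ^ (((k : ℤ) - n + 1) ^ 2) with hv
  have hu0 : 0 < u := by positivity
  have hv0 : 0 < v := by positivity
  have h2 : u / gaussMass lam ≤ u := div_le_self hu0.le hZ
  have h3 : 0 ≤ u / gaussMass lam := by positivity
  have h4 : lam ^ (2 * n) * (u + v) ≤ u + v :=
    mul_le_of_le_one_left (by positivity) (pow_le_one₀ h0.le hlam.2.le)
  rw [abs_le] at *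
  constructor <;> linarith

lemma summable_mul_edgeStep {lam : ℝ} (hlam : lam ∈ Set.Ioo (0 : ℝ) 1) (n : ℕ) {f : ℕ → ℝ}
    (hf : ∀ k : ℕ, |f k| ≤ 1 + ((k : ℝ) - n) ^ 2) : Summable fun k => f k * edgeStep lam n k := by
  have h0 := hlam.1
  refine Summable.of_norm_bounded ((summable_stepBound_sub hlam n).mul_left 2) fun k => ?_
  rw [Real.norm_eq_abs, abs_mul, stepBound]
  refine (mul_le_mul (hf k) (abs_edgeStep_le hlam n k) (abs_nonneg _) (by positivity)).trans_eq ?_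
  push_cast
  ring

lemma hasSum_edgeStep {lam : ℝ} (hlam : lam ∈ Set.Ioo (0 : ℝ) 1) (n : ℕ) :
    HasSum (edgeStep lam n) 1 := by
  have hs : Summable (edgeStep lam n) := by
    refine (summable_mul_edgeStep hlam n (f := fun _ => 1) fun k => ?_).congr fun k => one_mul _
    rw [abs_one]
    linarith [sq_nonneg ((k : ℝ) - n)]
  have h1 := hs.hasSum.tendsto_sum_nat
  have h2 : Tendsto (fun m => ∑ k ∈ Finset.range m, edgeStep lam n k) atTop (nhds (1 - 0)) := by
    have := (tendsto_upsFirst hlam (n + 1)).const_sub 1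
    refine this.congr fun m => ?_
    simp only [edgeStep]
    rw [Finset.sum_range_sub', upsFirst_zero_right]
  rw [sub_zero] at h2
  exact tendsto_nhds_unique h1 h2 ▸ hs.hasSum

lemma tsum_int_eq_zero_of_odd {f : ℤ → ℝ} (hf : ∀ x, f (-x) = -f x) : ∑' x, f x = 0 := by
  have h : ∑' x, f (-x) = ∑' x, f x := (Equiv.neg ℤ).tsum_eq f
  simp only [hf, tsum_neg] at h
  linarith

lemma mul_abs_tsum_le_of_odd {f g : ℤ → ℝ} (hodd : ∀ x, f (-x) = -f x) (hg : Summable g)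
    (hfg : ∀ x, |f x| ≤ g x) (hxfg : ∀ x : ℤ, |(x : ℝ)| * |f x| ≤ g x) (n : ℕ) :
    n * |∑' k : ℕ, f (k - n)| ≤ ∑' x, g x := by
  have hinj : Function.Injective fun x : ℤ => x - n := fun a b h => by simpa using h
  have hsumm : Summable fun x : ℤ => f (x - n) :=
    (Summable.of_norm_bounded hg hfg).comp_injective hinj
  have hzero : ∑' x : ℤ, f (x - n) = 0 :=
    ((Equiv.subRight (n : ℤ)).tsum_eq f).trans (tsum_int_eq_zero_of_odd hodd)
  have hinj1 : Function.Injective fun k : ℕ => (k : ℤ) := Nat.cast_injective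
  have hinj2 : Function.Injective fun k : ℕ => -((k : ℤ) + 1) := fun a b h => by simpa using h
  have hinj3 : Function.Injective fun k : ℕ => -((k : ℤ) + 1) - n := hinj.comp hinj2
  have hsplit : ∑' x : ℤ, f (x - n) =
      ∑' k : ℕ, f (k - n) + ∑' k : ℕ, f (-((k : ℤ) + 1) - n) :=
    tsum_of_nat_of_neg_add_one (f := fun x : ℤ => f (x - n))
      (hsumm.comp_injective hinj1) (hsumm.comp_injective hinj2)
  have hg0 (x : ℤ) : 0 ≤ g x := (abs_nonneg _).trans (hfg x)
  have hle : ‖∑' k : ℕ, n * f (-((k : ℤ) + 1) - n)‖ ≤ ∑' k : ℕ, g (-((k : ℤ) + 1) - n) := by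
    refine tsum_of_norm_bounded (hg.comp_injective hinj3).hasSum fun k => ?_
    refine le_trans ?_ (hxfg (-((k : ℤ) + 1) - n))
    rw [norm_mul, Real.norm_eq_abs, Real.norm_eq_abs, Nat.abs_cast]
    refine mul_le_mul_of_nonneg_right ?_ (abs_nonneg _)
    push_cast
    rw [le_abs]
    right
    linarith [(Nat.cast_nonneg k : (0 : ℝ) ≤ k)]
  rw [tsum_mul_left, norm_mul, Real.norm_eq_abs, Real.norm_eq_abs, Nat.abs_cast] at hle
  have heq : ∑' k : ℕ, f (k - n) = -∑' k : ℕ, f (-((k : ℤ) + 1) - n) := by linarith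
  rw [heq, abs_neg]
  exact hle.trans (tsum_comp_le_tsum_of_inj hg hg0 hinj3)

lemma mul_abs_tsum_gauss_le {lam : ℝ} (hlam : lam ∈ Set.Ioo (0 : ℝ) 1) (n : ℕ) :
    n * |∑' k : ℕ, ((k : ℝ) - n) * lam ^ (((k : ℤ) - n) ^ 2)| ≤ ∑' x, stepBound lam x := by
  have h0 := hlam.1
  have h := mul_abs_tsum_le_of_odd (f := fun x : ℤ => (x : ℝ) * lam ^ (x ^ 2))
    (g := stepBound lam) (fun x => by simp) (summable_stepBound hlam) (fun x => ?_) (fun x => ?_) n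
  · simpa using h
  · rw [abs_mul, abs_of_pos (zpow_pos h0 _), stepBound]
    exact mul_le_mul (abs_le_one_add_sq _) (le_add_of_nonneg_right (zpow_pos h0 _).le)
      (zpow_pos h0 _).le (by positivity)
  · rw [abs_mul, abs_of_pos (zpow_pos h0 _), stepBound, ← mul_assoc, abs_mul_abs_self]
    exact mul_le_mul (by nlinarith) (le_add_of_nonneg_right (zpow_pos h0 _).le)
      (zpow_pos h0 _).le (by positivity)

lemma exists_edgeStep_mean_bound {lam : ℝ} (hlam : lam ∈ Set.Ioo (0 : ℝ) 1) :
    ∃ C : ℝ, ∀ n : ℕ, n * |∑' k : ℕ, ((k : ℝ) - n) * edgeStep lam n k| ≤ C := by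
  have h0 := hlam.1
  have hZ := one_le_gaussMass hlam
  have hZ0 : 0 < gaussMass lam := by linarith
  set B := ∑' x, stepBound lam x with hB
  have hB0 : 0 ≤ B := tsum_nonneg (stepBound_nonneg hlam)
  have hq : Summable fun n : ℕ => (n : ℝ) ^ 1 * (lam ^ 2) ^ n :=
    summable_pow_mul_geometric_of_norm_lt_one 1 (by
      rw [Real.norm_of_nonneg (by positivity)]
      exact pow_lt_one₀ h0.le hlam.2 two_ne_zero)
  set K := ∑' n : ℕ, (n : ℝ) ^ 1 * (lam ^ 2) ^ n with hK
  refine ⟨K * B + B, fun n => ?_⟩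
  have hnK : n * lam ^ (2 * n) ≤ K := by
    have := hq.le_tsum n fun j _ => by positivity
    rwa [pow_one, ← pow_mul] at this
  have hs1 := summable_mul_edgeStep hlam n (f := fun k => (k : ℝ) - n)
    fun k => abs_le_one_add_sq _
  have hs2 : Summable fun k : ℕ =>
      ((k : ℝ) - n) * (lam ^ (((k : ℤ) - n) ^ 2) / gaussMass lam) := by
    refine Summable.of_norm_bounded (summable_stepBound_sub hlam n) fun k => ?_
    rw [Real.norm_eq_abs, abs_mul, stepBound, abs_of_nonneg (by positivity :
      0 ≤ lam ^ (((k : ℤ) - n) ^ 2) / gaussMass lam)]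
    push_cast
    refine mul_le_mul (abs_le_one_add_sq _) ?_ (by positivity) (by positivity)
    exact (div_le_self (by positivity) hZ).trans (le_add_of_nonneg_right (by positivity))
  have hdiff : |∑' k : ℕ, (((k : ℝ) - n) * edgeStep lam n k -
      ((k : ℝ) - n) * (lam ^ (((k : ℤ) - n) ^ 2) / gaussMass lam))| ≤ lam ^ (2 * n) * B := by
    have hle : ‖∑' k : ℕ, (((k : ℝ) - n) * edgeStep lam n k -
        ((k : ℝ) - n) * (lam ^ (((k : ℤ) - n) ^ 2) / gaussMass lam))‖ ≤
        ∑' k : ℕ, lam ^ (2 * n) * stepBound lam (k - n) := by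
      refine tsum_of_norm_bounded ((summable_stepBound_sub hlam n).mul_left _).hasSum fun k => ?_
      rw [← mul_sub, Real.norm_eq_abs, abs_mul, stepBound]
      refine (mul_le_mul (abs_le_one_add_sq _) (abs_edgeStep_sub_le hlam n k) (abs_nonneg _)
        (by positivity)).trans_eq ?_
      push_cast
      ring
    rw [tsum_mul_left] at hle
    exact hle.trans (by gcongr; exact tsum_stepBound_sub_le hlam n)
  rw [hs1.tsum_sub hs2] at hdiff
  have hpi := mul_abs_tsum_gauss_le hlam n
  have hpi2 : n * |∑' k : ℕ, ((k : ℝ) - n) * (lam ^ (((k : ℤ) - n) ^ 2) / gaussMass lam)| ≤ B := by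
    simp only [← mul_div_assoc]
    rw [tsum_div_const, abs_div, abs_of_pos hZ0, ← mul_div_assoc]
    exact (div_le_self (by positivity) hZ).trans hpi
  set a := ∑' k : ℕ, ((k : ℝ) - n) * edgeStep lam n k
  set c := ∑' k : ℕ, ((k : ℝ) - n) * (lam ^ (((k : ℤ) - n) ^ 2) / gaussMass lam)
  have hn0 : (0 : ℝ) ≤ n := Nat.cast_nonneg n
  calc n * |a| ≤ n * (|a - c| + |c|) := by
        gcongr
        linarith [abs_sub_abs_le_abs_sub a c]
    _ ≤ n * (lam ^ (2 * n) * B) + B := by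
        rw [mul_add]
        gcongr
    _ ≤ K * B + B := by
        rw [← mul_assoc]
        gcongr

lemma exists_edgeStep_drift_bound {lam : ℝ} (hlam : lam ∈ Set.Ioo (0 : ℝ) 1) :
    ∃ C : ℝ, 0 ≤ C ∧ ∀ b n : ℕ, (b : ℝ) / 2 < n →
      Summable (fun k : ℕ => edgeStep lam n k * ((k : ℝ) - b) ^ 2) ∧
      ∑' k : ℕ, edgeStep lam n k * ((k : ℝ) - b) ^ 2 ≤ ((n : ℝ) - b) ^ 2 + C := by
  have h0 := hlam.1
  obtain ⟨M, hM⟩ := exists_edgeStep_mean_bound hlam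
  set B := ∑' x, stepBound lam x with hB
  have hB0 : 0 ≤ B := tsum_nonneg (stepBound_nonneg hlam)
  have hM0 : 0 ≤ M := by simpa using hM 0
  refine ⟨2 * B + 2 * M, by positivity, fun b n hbn => ?_⟩
  have hs0 := hasSum_edgeStep hlam n
  have hs1 := summable_mul_edgeStep hlam n (f := fun k => (k : ℝ) - n)
    fun k => abs_le_one_add_sq _
  have hs2 := summable_mul_edgeStep hlam n (f := fun k => ((k : ℝ) - n) ^ 2)
    fun k => by rw [abs_of_nonneg (sq_nonneg _)]; linarith
  have hsum := (hs2.hasSum.add (hs1.hasSum.mul_left (2 * ((n : ℝ) - b)))).add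
    (hs0.mul_left (((n : ℝ) - b) ^ 2))
  have hsum' : HasSum (fun k : ℕ => edgeStep lam n k * ((k : ℝ) - b) ^ 2) _ :=
    hsum.congr_fun fun k => by ring
  refine ⟨hsum'.summable, ?_⟩
  rw [hsum'.tsum_eq]
  have hvar : ∑' k : ℕ, ((k : ℝ) - n) ^ 2 * edgeStep lam n k ≤ 2 * B := by
    have hle : ‖∑' k : ℕ, ((k : ℝ) - n) ^ 2 * edgeStep lam n k‖ ≤
        ∑' k : ℕ, 2 * stepBound lam (k - n) := by
      refine tsum_of_norm_bounded ((summable_stepBound_sub hlam n).mul_left _).hasSum fun k => ?_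
      rw [Real.norm_eq_abs, abs_mul, stepBound, abs_of_nonneg (sq_nonneg _)]
      refine (mul_le_mul (le_add_of_nonneg_left zero_le_one) (abs_edgeStep_le hlam n k)
        (abs_nonneg _) (by positivity)).trans_eq ?_
      push_cast
      ring
    rw [tsum_mul_left] at hle
    linarith [Real.le_norm_self (∑' k : ℕ, ((k : ℝ) - n) ^ 2 * edgeStep lam n k),
      tsum_stepBound_sub_le hlam n]
  have hmean : ((n : ℝ) - b) * ∑' k : ℕ, ((k : ℝ) - n) * edgeStep lam n k ≤ M := by
    refine le_trans ?_ (hM n)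
    refine (le_abs_self _).trans ?_
    rw [abs_mul]
    gcongr
    rw [abs_le]
    constructor <;> linarith [(Nat.cast_nonneg b : (0 : ℝ) ≤ b)]
  linarith
lemma measure_next_step {E : Type*} [Countable E] [MeasurableSpace E] [MeasurableSingletonClass E]
    {M : Measure (ℕ → E)} [IsProbabilityMeasure M] {f : E → ℝ} {K : E → E → ℝ}
    (hM : ∀ (n : ℕ) (p : ℕ → E), (M {ω | ∀ i ≤ n, ω i = p i}).toReal =
      f (p 0) * ∏ i ∈ Finset.range n, K (p i) (p (i + 1)))
    (n : ℕ) (A : Set (Fin (n + 1) → E)) (x y : E) :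
    M {ω | (fun i : Fin (n + 1) => ω i) ∈ A ∧ ω n = x ∧ ω (n + 1) = y} =
      M {ω | (fun i : Fin (n + 1) => ω i) ∈ A ∧ ω n = x} * ENNReal.ofReal (K x y) := by
  set φ : (ℕ → E) → (Fin (n + 1) → E) := fun ω i => ω i with hφ
  have hφm : Measurable φ := measurable_pi_lambda _ fun i => measurable_pi_apply _
  have hcyl (p : ℕ → E) : M {ω | ∀ i ≤ n + 1, ω i = p i} =
      M {ω | ∀ i ≤ n, ω i = p i} * ENNReal.ofReal (K (p n) (p (n + 1))) := by
    rw [← ENNReal.ofReal_toReal (measure_ne_top M {ω | ∀ i ≤ n + 1, ω i = p i}),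
      ← ENNReal.ofReal_toReal (measure_ne_top M {ω | ∀ i ≤ n, ω i = p i}),
      ← ENNReal.ofReal_mul ENNReal.toReal_nonneg, hM, hM, Finset.prod_range_succ, mul_assoc]
  have key : (M.restrict {ω | ω n = x ∧ ω (n + 1) = y}).map φ =
      ENNReal.ofReal (K x y) • (M.restrict {ω | ω n = x}).map φ := by
    refine Measure.ext_of_singleton fun r => ?_
    have hr : MeasurableSet (φ ⁻¹' {r}) := hφm (measurableSet_singleton r)
    rw [Measure.smul_apply, Measure.map_apply hφm (measurableSet_singleton r),
      Measure.map_apply hφm (measurableSet_singleton r), Measure.restrict_apply hr,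
      Measure.restrict_apply hr, smul_eq_mul, mul_comm]
    by_cases hx : r (Fin.last n) = x
    · have h := hcyl fun i => if h : i < n + 1 then r ⟨i, h⟩ else y
      have h1 : {ω : ℕ → E | ∀ i ≤ n, ω i = if h : i < n + 1 then r ⟨i, h⟩ else y} =
          φ ⁻¹' {r} ∩ {ω | ω n = x} := by
        ext ω
        simp only [Set.mem_ofPred_eq, Set.mem_inter_iff, Set.mem_preimage, Set.mem_singleton_iff,
          hφ, funext_iff]
        constructor
        · intro h
          have h' (i : Fin (n + 1)) : ω i = r i :=
            (h i (Nat.lt_succ_iff.mp i.2)).trans (dif_pos i.2)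
          exact ⟨h', by simpa [hx] using h' (Fin.last n)⟩
        · rintro ⟨h, -⟩ i hi
          rw [dif_pos (Nat.lt_succ_of_le hi)]
          exact h ⟨i, Nat.lt_succ_of_le hi⟩
      have h2 : {ω : ℕ → E | ∀ i ≤ n + 1, ω i = if h : i < n + 1 then r ⟨i, h⟩ else y} =
          φ ⁻¹' {r} ∩ {ω | ω n = x ∧ ω (n + 1) = y} := by
        have : {ω : ℕ → E | ∀ i ≤ n + 1, ω i = if h : i < n + 1 then r ⟨i, h⟩ else y} =
            {ω : ℕ → E | ∀ i ≤ n, ω i = if h : i < n + 1 then r ⟨i, h⟩ else y} ∩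
              {ω | ω (n + 1) = y} := by
          ext ω
          simp only [Nat.le_succ_iff, Set.mem_ofPred_eq, Set.mem_inter_iff, or_imp, forall_and,
            forall_eq]
          simp
        rw [this, h1, Set.inter_assoc]
        rfl
      have hl : r ⟨n, Nat.lt_succ_self n⟩ = x := hx
      rw [h1, h2] at h
      simpa [hl] using h
    · have h1 : φ ⁻¹' {r} ∩ {ω | ω n = x} = ∅ := by
        refine Set.eq_empty_of_forall_notMem ?_
        rintro ω ⟨rfl, h⟩
        exact hx h
      have h2 : φ ⁻¹' {r} ∩ {ω | ω n = x ∧ ω (n + 1) = y} = ∅ := by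
        refine Set.eq_empty_of_forall_notMem ?_
        rintro ω ⟨rfl, h, -⟩
        exact hx h
      rw [h1, h2]
      simp
  have hA : MeasurableSet A := A.to_countable.measurableSet
  have h := congrArg (fun ν : Measure (Fin (n + 1) → E) => ν A) key
  simp only [Measure.smul_apply, smul_eq_mul] at h
  rw [Measure.map_apply hφm hA, Measure.map_apply hφm hA, Measure.restrict_apply (hφm hA),
    Measure.restrict_apply (hφm hA), mul_comm] at h
  exact h

lemma urnStep_up (lam : ℝ) (i : ℤ) :
    urnStep lam i (i + 1) = lam ^ (2 * i - 1) / (1 + lam ^ (2 * i - 1)) := by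
  simp [urnStep]

lemma urnStep_down (lam : ℝ) (i : ℤ) : urnStep lam i (i - 1) = 1 / (1 + lam ^ (2 * i - 1)) := by
  rw [urnStep, if_neg (by omega), if_pos rfl]

/-- The probability that the urn discrepancy chain started at `1` makes, in its first `n + k`
steps, exactly `n` down-steps and `k` up-steps. -/
def visitProb (lam : ℝ) (n k : ℕ) : ℝ := upsFirst lam (n + 1) k - upsFirst lam n (k + 1)

lemma zpow_two_mul_sub_one {lam : ℝ} (hlam : lam ∈ Set.Ioo (0 : ℝ) 1) (n k : ℕ) :
    lam ^ (2 * (1 + (k : ℤ) - n) - 1) = lam ^ (2 * k + 1) / lam ^ (2 * n) := by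
  rw [← zpow_natCast, ← zpow_natCast, ← zpow_sub₀ hlam.1.ne']
  congr 1
  push_cast
  ring

lemma visitProb_mul_down {lam : ℝ} (hlam : lam ∈ Set.Ioo (0 : ℝ) 1) (n k : ℕ) :
    visitProb lam n k * urnStep lam (1 + k - n) (1 + k - n - 1) = edgeStep lam n k := by
  have h0 := hlam.1
  have h := upsFirst_succ_succ hlam n k
  rw [urnStep_down, zpow_two_mul_sub_one hlam, visitProb, edgeStep]
  field_simp
  linarith

lemma visitProb_mul_up {lam : ℝ} (hlam : lam ∈ Set.Ioo (0 : ℝ) 1) (n k : ℕ) :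
    visitProb lam n k * urnStep lam (1 + k - n) (1 + k - n + 1) =
      upsFirst lam (n + 1) (k + 1) - upsFirst lam n (k + 1) := by
  have h0 := hlam.1
  have h := upsFirst_succ_succ hlam n k
  rw [urnStep_up, zpow_two_mul_sub_one hlam, visitProb]
  field_simp
  linarith

lemma measure_urn_next {lam : ℝ} {P : ℤ → Measure (ℕ → ℤ)} (hP : IsUrnChain lam P)
    (t : ℕ) (x y : ℤ) :
    P 1 {ω | ω t = x ∧ ω (t + 1) = y} = P 1 {ω | ω t = x} * ENNReal.ofReal (urnStep lam x y) := by
  have := hP.1 1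
  simpa using measure_next_step (M := P 1) (f := fun z => if z = 1 then 1 else 0)
    (hP.2 1) t Set.univ x y

lemma ofReal_visitProb_le {lam : ℝ} (hlam : lam ∈ Set.Ioo (0 : ℝ) 1) {P : ℤ → Measure (ℕ → ℤ)}
    (hP : IsUrnChain lam P) (t n k : ℕ) (ht : n + k = t) :
    ENNReal.ofReal (visitProb lam n k) ≤ P 1 {ω | ω t = 1 + k - n} := by
  have := hP.1 1
  have hdown {t n k : ℕ} (h : ENNReal.ofReal (visitProb lam n k) ≤ P 1 {ω | ω t = 1 + k - n}) :
      ENNReal.ofReal (edgeStep lam n k) ≤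
        P 1 {ω | ω t = 1 + k - n ∧ ω (t + 1) = 1 + k - n - 1} := by
    rw [measure_urn_next hP, ← visitProb_mul_down hlam, ENNReal.ofReal_mul' (by
      rw [urnStep_down]; have := hlam.1; positivity)]
    gcongr
  have hup {t n k : ℕ} (h : ENNReal.ofReal (visitProb lam n k) ≤ P 1 {ω | ω t = 1 + k - n}) :
      ENNReal.ofReal (upsFirst lam (n + 1) (k + 1) - upsFirst lam n (k + 1)) ≤
        P 1 {ω | ω t = 1 + k - n ∧ ω (t + 1) = 1 + k - n + 1} := by
    rw [measure_urn_next hP, ← visitProb_mul_up hlam, ENNReal.ofReal_mul' (by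
      rw [urnStep_up]; have := hlam.1; positivity)]
    gcongr
  induction t generalizing n k with
  | zero =>
    obtain ⟨rfl, rfl⟩ : n = 0 ∧ k = 0 := by omega
    have h := hP.2 1 0 fun _ => 1
    simp only [Nat.le_zero, forall_eq, Finset.range_zero, Finset.prod_empty, if_true, mul_one] at h
    rw [visitProb, upsFirst_zero_right, upsFirst_zero_succ, sub_zero, ← h,
      ENNReal.ofReal_toReal (measure_ne_top _ _)]
    simp
  | succ t ih =>
    cases n with
    | zero =>
      obtain ⟨k, rfl⟩ : ∃ k', k = k' + 1 := ⟨t, by omega⟩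
      have h := hup (ih 0 k (by omega))
      rw [upsFirst_zero_succ] at h
      rw [visitProb, upsFirst_zero_succ]
      refine h.trans (measure_mono fun ω hω => ?_)
      simp only [Set.mem_ofPred_eq] at hω ⊢
      push_cast at *
      omega
    | succ n =>
      cases k with
      | zero =>
        have h := hdown (ih n 0 (by omega))
        rw [edgeStep, upsFirst_zero_right] at h
        rw [visitProb, upsFirst_zero_right]
        refine h.trans (measure_mono fun ω hω => ?_)
        simp only [Set.mem_ofPred_eq] at hω ⊢
        push_cast at *
        omega
      | succ k =>
        have h1 := hdown (ih n (k + 1) (by omega))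
        have h2 := hup (ih (n + 1) k (by omega))
        have e : visitProb lam (n + 1) (k + 1) = edgeStep lam n (k + 1) +
            (upsFirst lam (n + 1 + 1) (k + 1) - upsFirst lam (n + 1) (k + 1)) := by
          rw [visitProb, edgeStep]
          ring
        rw [e]
        refine ENNReal.ofReal_add_le.trans ((add_le_add h1 h2).trans ?_)
        rw [← measure_union]
        · refine measure_mono fun ω hω => ?_
          simp only [Set.mem_union, Set.mem_ofPred_eq] at hω ⊢
          push_cast at *
          omega
        · rw [Set.disjoint_left]
          intro ω hω
          simp only [Set.mem_ofPred_eq] at hω ⊢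
          push_cast at *
          omega
        · exact (measurable_pi_apply _ (measurableSet_singleton _)).inter
            (measurable_pi_apply _ (measurableSet_singleton _))

lemma ae_urn_path {lam : ℝ} {P : ℤ → Measure (ℕ → ℤ)} (hP : IsUrnChain lam P) :
    ∀ᵐ ω ∂(P 1), ω 0 = 1 ∧ ∀ t, ω (t + 1) = ω t + 1 ∨ ω (t + 1) = ω t - 1 := by
  have := hP.1 1
  refine eventually_and.mpr ⟨?_, ae_all_iff.mpr fun t => ?_⟩
  · have h := hP.2 1 0 fun _ => 1
    simp only [Nat.le_zero, forall_eq, Finset.range_zero, Finset.prod_empty, if_true, mul_one] at h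
    have h1 : P 1 {ω | ω 0 = 1} = 1 := by
      rw [← ENNReal.ofReal_toReal (measure_ne_top (P 1) {ω | ω 0 = 1}), h, ENNReal.ofReal_one]
    exact (mem_ae_iff_prob_eq_one (measurable_pi_apply 0 (measurableSet_singleton _))).mpr h1
  · have h : ∀ᵐ ω ∂(P 1), ∀ x y : ℤ, ¬(y = x + 1 ∨ y = x - 1) → ¬(ω t = x ∧ ω (t + 1) = y) := by
      refine ae_all_iff.mpr fun x => ae_all_iff.mpr fun y => ?_
      by_cases hxy : y = x + 1 ∨ y = x - 1
      · simp [hxy]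
      · rw [not_or] at hxy
        have h0 : P 1 {ω | ω t = x ∧ ω (t + 1) = y} = 0 := by
          rw [measure_urn_next hP, urnStep, if_neg hxy.1, if_neg hxy.2]
          simp
        have h1 : ∀ᵐ ω ∂(P 1), ¬(ω t = x ∧ ω (t + 1) = y) := by
          rw [ae_iff]
          simpa using h0
        exact h1.mono fun ω hω _ => hω
    filter_upwards [h] with ω hω
    by_contra hcon
    exact hω _ _ hcon ⟨rfl, rfl⟩

lemma downCount_succ (ω : ℕ → ℤ) (t : ℕ) :
    downCount ω (t + 1) = downCount ω t + if ω (t + 1) = ω t - 1 then 1 else 0 := by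
  simp only [downCount, Finset.card_filter]
  rw [Finset.sum_Icc_succ_top (by omega), Nat.add_sub_cancel]

lemma downCount_mono (ω : ℕ → ℤ) : Monotone (downCount ω) :=
  monotone_nat_of_le_succ fun t => by
    rw [downCount_succ]
    exact Nat.le_add_right _ _

lemma urn_path_eq {ω : ℕ → ℤ} (h0 : ω 0 = 1)
    (h : ∀ t, ω (t + 1) = ω t + 1 ∨ ω (t + 1) = ω t - 1) (t : ℕ) :
    ω t = 1 + t - 2 * downCount ω t := by
  induction t with
  | zero => simp [h0, downCount]
  | succ t ih =>
    rw [downCount_succ]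
    rcases h t with h | h
    · rw [if_neg (by omega), h, ih]
      push_cast
      ring
    · rw [if_pos h, h, ih]
      push_cast
      ring

lemma betaTime_eq {ω : ℕ → ℤ} (h0 : ω 0 = 1)
    (h : ∀ t, ω (t + 1) = ω t + 1 ∨ ω (t + 1) = ω t - 1) {n k : ℕ}
    (h1 : ω (n + k) = 1 + k - n) (h2 : ω (n + k + 1) = k - n) :
    betaTime ω (n + 1) = n + k + 1 := by
  have e1 := urn_path_eq h0 h (n + k)
  have e2 := urn_path_eq h0 h (n + k + 1)
  push_cast at e1 e2
  refine IsLeast.csInf_eq ⟨⟨by omega, by omega⟩, fun j hj => ?_⟩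
  by_contra hlt
  have := downCount_mono ω (show j ≤ n + k by omega)
  have := hj.2
  omega

lemma measure_betaTime {lam : ℝ} (hlam : lam ∈ Set.Ioo (0 : ℝ) 1) {P : ℤ → Measure (ℕ → ℤ)}
    (hP : IsUrnChain lam P) (n k : ℕ) :
    (P 1 {ω | ω (betaTime ω (n + 1)) = (k : ℤ) - n}).toReal = edgeStep lam n k := by
  have := hP.1 1
  set F : ℕ → Set (ℕ → ℤ) := fun k => {ω | ω (n + k) = 1 + k - n ∧ ω (n + k + 1) = k - n} with hF
  have hFm (k : ℕ) : MeasurableSet (F k) :=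
    (measurable_pi_apply _ (measurableSet_singleton _)).inter
      (measurable_pi_apply _ (measurableSet_singleton _))
  have hFsub : ∀ᵐ ω ∂(P 1), ∀ k, ω ∈ F k → ω (betaTime ω (n + 1)) = (k : ℤ) - n := by
    filter_upwards [ae_urn_path hP] with ω hω k hk
    rw [betaTime_eq hω.1 hω.2 hk.1 hk.2]
    exact hk.2
  have hdisj : Pairwise (Function.onFun (AEDisjoint (P 1)) F) := fun i j hij => by
    have : ∀ᵐ ω ∂(P 1), ω ∉ F i ∩ F j := by
      filter_upwards [hFsub] with ω hω hmem
      have h1 := hω i hmem.1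
      have h2 := hω j hmem.2
      omega
    simpa [Function.onFun, AEDisjoint, ae_iff] using this
  have hsum : P 1 (⋃ k, F k) = ∑' k, P 1 (F k) :=
    measure_iUnion₀ hdisj fun k => (hFm k).nullMeasurableSet
  have hge (k : ℕ) : edgeStep lam n k ≤ (P 1 (F k)).toReal := by
    rw [← ENNReal.ofReal_le_iff_le_toReal (measure_ne_top _ _)]
    have h := measure_urn_next hP (n + k) (1 + k - n) (1 + k - n - 1)
    have hset : {ω : ℕ → ℤ | ω (n + k) = 1 + k - n ∧ ω (n + k + 1) = 1 + k - n - 1} = F k := by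
      simp only [hF, show (1 : ℤ) + k - n - 1 = k - n by ring]
    rw [← hset, h, ← visitProb_mul_down hlam, ENNReal.ofReal_mul' (by
      rw [urnStep_down]; have := hlam.1; positivity)]
    gcongr
    exact ofReal_visitProb_le hlam hP _ n k rfl
  have hne : ∑' k, P 1 (F k) ≠ ⊤ := hsum ▸ measure_ne_top _ _
  have hs : HasSum (fun k => (P 1 (F k)).toReal) (P 1 (⋃ k, F k)).toReal := by
    rw [hsum, ENNReal.tsum_toReal_eq fun k => measure_ne_top _ _]
    exact ENNReal.hasSum_toReal hne
  have hle1 : (P 1 (⋃ k, F k)).toReal ≤ 1 := ENNReal.toReal_le_of_le_ofReal zero_le_one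
    (by simpa using prob_le_one)
  have hd := hs.sub (hasSum_edgeStep hlam n)
  have hd0 : (P 1 (⋃ k, F k)).toReal - 1 = 0 :=
    le_antisymm (by linarith) (hd.nonneg fun k => sub_nonneg.mpr (hge k))
  rw [hd0, hasSum_zero_iff_of_nonneg fun k => sub_nonneg.mpr (hge k)] at hd
  have hFk : (P 1 (F k)).toReal = edgeStep lam n k := by
    have := congrFun hd k
    simp only [Pi.zero_apply] at this
    linarith
  have hU : P 1 (⋃ k, F k) = 1 := by
    rw [← ENNReal.ofReal_toReal (measure_ne_top (P 1) (⋃ k, F k)), sub_eq_zero.mp hd0,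
      ENNReal.ofReal_one]
  have hUae : ∀ᵐ ω ∂(P 1), ω ∈ ⋃ k, F k :=
    (mem_ae_iff_prob_eq_one (MeasurableSet.iUnion hFm)).mpr hU
  rw [← hFk]
  congr 1
  refine measure_congr ?_
  filter_upwards [hFsub, hUae] with ω hω hmem
  refine propext ⟨fun h => ?_, fun h => hω k h⟩
  obtain ⟨j, hj⟩ := Set.mem_iUnion.mp hmem
  have h1 := hω j hj
  obtain rfl : j = k := by
    have h2 : ω (betaTime ω (n + 1)) = (k : ℤ) - n := h
    omega
  exact hj
lemma edgeStep_nonneg {lam : ℝ} (hlam : lam ∈ Set.Ioo (0 : ℝ) 1) {P : ℤ → Measure (ℕ → ℤ)}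
    (hP : IsUrnChain lam P) (n k : ℕ) : 0 ≤ edgeStep lam n k :=
  measure_betaTime hlam hP n k ▸ ENNReal.toReal_nonneg

/-- The paths that stay above `b / 2` up to time `j`. -/
def highPaths (b j : ℕ) : Set (ℕ → ℕ) := {ω | ∀ i ≤ j, (b : ℝ) / 2 < (ω i : ℝ)}

lemma measurableSet_highPaths (b j : ℕ) : MeasurableSet (highPaths b j) := by
  have : highPaths b j = ⋂ i, ⋂ (_ : i ≤ j), (fun ω => ω i) ⁻¹' {s : ℕ | (b : ℝ) / 2 < s} := by
    ext ω
    simp [highPaths]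
  rw [this]
  exact MeasurableSet.iInter fun i => MeasurableSet.iInter fun _ =>
    measurable_pi_apply i (Set.to_countable _).measurableSet

lemma measurableSet_eval_eq (j s : ℕ) : MeasurableSet {ω : ℕ → ℕ | ω j = s} :=
  (measurable_pi_apply j : Measurable fun ω : ℕ → ℕ => ω j) (measurableSet_singleton s)

lemma measure_eq_tsum_inter_eval (M : Measure (ℕ → ℕ)) {A : Set (ℕ → ℕ)} (hA : MeasurableSet A)
    (j : ℕ) : M A = ∑' s, M (A ∩ {ω | ω j = s}) := by
  rw [← measure_iUnion]
  · congr 1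
    ext ω
    simp
  · intro s t hst
    rw [Function.onFun, Set.disjoint_left]
    rintro ω ⟨-, h1⟩ ⟨-, h2⟩
    exact hst (h1.symm.trans h2)
  · exact fun s => hA.inter (measurableSet_eval_eq j s)

lemma measure_edge_next {lam : ℝ} (hlam : lam ∈ Set.Ioo (0 : ℝ) 1) {P : ℤ → Measure (ℕ → ℤ)}
    (hP : IsUrnChain lam P) {Q : ℕ → Measure (ℕ → ℕ)} (hQ : IsEdgeChain lam P Q) (b j s s' : ℕ) :
    Q b (highPaths b j ∩ {ω | ω (j + 1) = s'} ∩ {ω | ω j = s}) =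
      Q b (highPaths b j ∩ {ω | ω j = s}) * ENNReal.ofReal (edgeStep lam s s') := by
  have := hQ.1 b
  have h := measure_next_step (M := Q b) (f := fun z => if z = b then 1 else 0)
    (K := edgeStep lam) (fun n p => by
      rw [hQ.2]
      simp only [measure_betaTime hlam hP]) j {r | ∀ i, (b : ℝ) / 2 < (r i : ℝ)} s s'
  convert h using 2
  · ext ω
    simp only [highPaths, Set.mem_inter_iff, Set.mem_ofPred_eq, Fin.forall_iff, Nat.lt_succ_iff]
    tauto
  · congr 1
    ext ω
    simp only [highPaths, Set.mem_inter_iff, Set.mem_ofPred_eq, Fin.forall_iff, Nat.lt_succ_iff]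

lemma exists_tsum_ofReal_edgeStep_le {lam : ℝ} (hlam : lam ∈ Set.Ioo (0 : ℝ) 1) {P : ℤ → Measure (ℕ → ℤ)}
    (hP : IsUrnChain lam P) :
    ∃ C : ℝ, 0 ≤ C ∧ ∀ b n : ℕ, (b : ℝ) / 2 < n →
      ∑' k : ℕ, ENNReal.ofReal (edgeStep lam n k) * ENNReal.ofReal (((k : ℝ) - b) ^ 2) ≤
        ENNReal.ofReal (((n : ℝ) - b) ^ 2) + ENNReal.ofReal C := by
  obtain ⟨C, hC0, hC⟩ := exists_edgeStep_drift_bound hlam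
  refine ⟨C, hC0, fun b n hbn => ?_⟩
  obtain ⟨hs, hle⟩ := hC b n hbn
  have hnn (k : ℕ) : 0 ≤ edgeStep lam n k := edgeStep_nonneg hlam hP n k
  simp only [← ENNReal.ofReal_mul (hnn _)]
  rw [← ENNReal.ofReal_tsum_of_nonneg (fun k => mul_nonneg (hnn k) (sq_nonneg _)) hs,
    ← ENNReal.ofReal_add (sq_nonneg _) hC0]
  exact ENNReal.ofReal_le_ofReal hle

lemma exists_measure_compl_highPaths_add_le {lam : ℝ} (hlam : lam ∈ Set.Ioo (0 : ℝ) 1)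
    {P : ℤ → Measure (ℕ → ℤ)} (hP : IsUrnChain lam P) {Q : ℕ → Measure (ℕ → ℕ)}
    (hQ : IsEdgeChain lam P Q) :
    ∃ C : ℝ, 0 ≤ C ∧ ∀ b : ℕ, 0 < b → ∀ j : ℕ,
      ENNReal.ofReal ((b / 2 : ℝ) ^ 2) * Q b (highPaths b j)ᶜ +
        ∑' s : ℕ, Q b (highPaths b j ∩ {ω | ω j = s}) * ENNReal.ofReal (((s : ℝ) - b) ^ 2) ≤
      j * ENNReal.ofReal C := by
  obtain ⟨C, hC0, hC⟩ := exists_tsum_ofReal_edgeStep_le hlam hP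
  refine ⟨C, hC0, fun b hb j => ?_⟩
  have := hQ.1 b
  have hb' : (0 : ℝ) < b := by exact_mod_cast hb
  induction j with
  | zero =>
    have hstart : ∀ᵐ ω ∂(Q b), ω 0 = b := by
      have h := hQ.2 b 0 fun _ => b
      simp only [Nat.le_zero, forall_eq, Finset.range_zero, Finset.prod_empty, if_true,
        mul_one] at h
      refine (mem_ae_iff_prob_eq_one (measurableSet_eval_eq 0 b)).mpr ?_
      rw [← ENNReal.ofReal_toReal (measure_ne_top (Q b) {ω | ω 0 = b}), h, ENNReal.ofReal_one]
    have h1 : Q b (highPaths b 0)ᶜ = 0 := by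
      have : ∀ᵐ ω ∂(Q b), ω ∈ highPaths b 0 := by
        filter_upwards [hstart] with ω hω
        intro i hi
        rw [Nat.le_zero.mp hi, hω]
        linarith
      exact this
    have h2 (s : ℕ) : Q b (highPaths b 0 ∩ {ω | ω 0 = s}) * ENNReal.ofReal (((s : ℝ) - b) ^ 2)
        = 0 := by
      by_cases hs : s = b
      · simp [hs]
      · refine mul_eq_zero_of_left (measure_mono_null Set.inter_subset_right ?_) _
        have : ∀ᵐ ω ∂(Q b), ¬ω 0 = s := by
          filter_upwards [hstart] with ω hω h
          exact hs (h.symm.trans hω)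
        simpa [ae_iff] using this
    simp [h1, h2]
  | succ j ih =>
    set c := ENNReal.ofReal ((b / 2 : ℝ) ^ 2) with hc
    set W : ℕ → ENNReal := fun s => ENNReal.ofReal (((s : ℝ) - b) ^ 2) with hW
    set G := highPaths b j with hG
    have hGm : MeasurableSet G := measurableSet_highPaths b j
    have hG' : highPaths b (j + 1) = G ∩ {ω | (b : ℝ) / 2 < (ω (j + 1) : ℝ)} := by
      ext ω
      simp only [hG, highPaths, Set.mem_inter_iff, Set.mem_ofPred_eq, Nat.le_succ_iff, or_imp,
        forall_and, forall_eq]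
    set L : Set (ℕ → ℕ) := {ω | (b : ℝ) / 2 < (ω (j + 1) : ℝ)} with hL
    have hLm : MeasurableSet L :=
      (measurable_pi_apply (j + 1) : Measurable fun ω : ℕ → ℕ => ω (j + 1)) (Set.to_countable {s : ℕ | (b : ℝ) / 2 < s}).measurableSet
    have hsplit : Q b (G ∩ L)ᶜ ≤ Q b Gᶜ + Q b (G ∩ Lᶜ) := by
      refine (measure_mono fun ω hω => ?_).trans (measure_union_le _ _)
      simp only [Set.mem_compl_iff, Set.mem_inter_iff, Set.mem_union] at hω ⊢
      tauto
    have hterm (s : ℕ) : c * Q b (G ∩ Lᶜ ∩ {ω | ω (j + 1) = s}) +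
        Q b (G ∩ L ∩ {ω | ω (j + 1) = s}) * W s ≤ Q b (G ∩ {ω | ω (j + 1) = s}) * W s := by
      by_cases hs : (b : ℝ) / 2 < s
      · have he : G ∩ Lᶜ ∩ {ω | ω (j + 1) = s} = ∅ := by
          refine Set.eq_empty_of_forall_notMem ?_
          rintro ω ⟨⟨-, h1⟩, rfl⟩
          exact h1 hs
        rw [he, measure_empty, mul_zero, zero_add]
        gcongr
        exact Set.inter_subset_left
      · have he : G ∩ L ∩ {ω | ω (j + 1) = s} = ∅ := by
          refine Set.eq_empty_of_forall_notMem ?_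
          rintro ω ⟨⟨-, h1⟩, rfl⟩
          exact hs h1
        rw [he, measure_empty, zero_mul, add_zero, mul_comm]
        have hcW : c ≤ W s := ENNReal.ofReal_le_ofReal (by nlinarith)
        gcongr
        exact Set.inter_subset_left
    have hstep : ∑' s', Q b (G ∩ {ω | ω (j + 1) = s'}) * W s' ≤
        ∑' s, Q b (G ∩ {ω | ω j = s}) * W s + ENNReal.ofReal C := by
      calc ∑' s', Q b (G ∩ {ω | ω (j + 1) = s'}) * W s'
          = ∑' s', ∑' s, Q b (G ∩ {ω | ω j = s}) *
              (ENNReal.ofReal (edgeStep lam s s') * W s') := by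
            refine tsum_congr fun s' => ?_
            rw [measure_eq_tsum_inter_eval (Q b) (hGm.inter (measurableSet_eval_eq (j + 1) s')) j,
              ← ENNReal.tsum_mul_right]
            exact tsum_congr fun s => by rw [measure_edge_next hlam hP hQ, mul_assoc]
        _ = ∑' s, Q b (G ∩ {ω | ω j = s}) *
              ∑' s', ENNReal.ofReal (edgeStep lam s s') * W s' := by
            rw [ENNReal.tsum_comm]
            exact tsum_congr fun s => ENNReal.tsum_mul_left
        _ ≤ ∑' s, Q b (G ∩ {ω | ω j = s}) * (W s + ENNReal.ofReal C) := by
            refine ENNReal.tsum_le_tsum fun s => ?_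
            by_cases hs : (b : ℝ) / 2 < s
            · gcongr
              exact hC b s hs
            · have he : G ∩ {ω | ω j = s} = ∅ := by
                refine Set.eq_empty_of_forall_notMem ?_
                rintro ω ⟨h1, rfl⟩
                exact hs (h1 j le_rfl)
              simp [he]
        _ = ∑' s, Q b (G ∩ {ω | ω j = s}) * W s + Q b G * ENNReal.ofReal C := by
            simp only [mul_add]
            rw [ENNReal.tsum_add, ENNReal.tsum_mul_right,
              ← measure_eq_tsum_inter_eval (Q b) hGm j]
        _ ≤ _ := by
            gcongr
            exact mul_le_of_le_one_left zero_le prob_le_one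
    rw [hG']
    calc c * Q b (G ∩ L)ᶜ + ∑' s, Q b (G ∩ L ∩ {ω | ω (j + 1) = s}) * W s
        ≤ c * (Q b Gᶜ + Q b (G ∩ Lᶜ)) + ∑' s, Q b (G ∩ L ∩ {ω | ω (j + 1) = s}) * W s := by
          gcongr
      _ = c * Q b Gᶜ + ∑' s, (c * Q b (G ∩ Lᶜ ∩ {ω | ω (j + 1) = s}) +
            Q b (G ∩ L ∩ {ω | ω (j + 1) = s}) * W s) := by
          rw [measure_eq_tsum_inter_eval (Q b) (hGm.inter hLm.compl) (j + 1), ENNReal.tsum_add,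
            ENNReal.tsum_mul_left, mul_add, add_assoc]
      _ ≤ c * Q b Gᶜ + ∑' s, Q b (G ∩ {ω | ω (j + 1) = s}) * W s := by
          gcongr with s
          exact hterm s
      _ ≤ c * Q b Gᶜ + (∑' s, Q b (G ∩ {ω | ω j = s}) * W s + ENNReal.ofReal C) := by
          gcongr
      _ ≤ j * ENNReal.ofReal C + ENNReal.ofReal C := by
          rw [← add_assoc]
          gcongr
      _ = ((j + 1 : ℕ) : ENNReal) * ENNReal.ofReal C := by
          push_cast
          ring

lemma exists_toReal_compl_highPaths_le {lam : ℝ} (hlam : lam ∈ Set.Ioo (0 : ℝ) 1)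
    {P : ℤ → Measure (ℕ → ℤ)} (hP : IsUrnChain lam P) {Q : ℕ → Measure (ℕ → ℕ)}
    (hQ : IsEdgeChain lam P Q) :
    ∃ C : ℝ, 0 ≤ C ∧ ∀ b : ℕ, 0 < b → ∀ j : ℕ,
      (Q b (highPaths b j)ᶜ).toReal ≤ C * (j / (b : ℝ) ^ 2) := by
  obtain ⟨C, hC0, hC⟩ := exists_measure_compl_highPaths_add_le hlam hP hQ
  refine ⟨4 * C, by positivity, fun b hb j => ?_⟩
  have := hQ.1 b
  have hb' : (0 : ℝ) < b := by exact_mod_cast hb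
  have h := ENNReal.toReal_mono (by finiteness) (le_self_add.trans (hC b hb j))
  rw [ENNReal.toReal_mul, ENNReal.toReal_mul, ENNReal.toReal_ofReal (sq_nonneg _),
    ENNReal.toReal_ofReal hC0, ENNReal.toReal_natCast] at h
  rw [← mul_div_assoc, le_div_iff₀ (by positivity)]
  linarith

/-- With probability tending to one as `b → ∞`, the edge-local-time chain started at `b`
stays above `b/2` during the first `⌊b^{2-δ}⌋` steps. -/
theorem edge_chain_stays_high (lam : ℝ) (hlam : lam ∈ Set.Ioo (0 : ℝ) 1)
    (P : ℤ → Measure (ℕ → ℤ)) (hP : IsUrnChain lam P)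
    (Q : ℕ → Measure (ℕ → ℕ)) (hQ : IsEdgeChain lam P Q) :
    ∀ δ > (0 : ℝ),
      Tendsto
        (fun b : ℕ =>
          (Q b {ω | ∀ j ≤ Nat.floor ((b : ℝ) ^ ((2 : ℝ) - δ)), (b : ℝ) / 2 < (ω j : ℝ)}).toReal)
        atTop (nhds 1) := by
  intro δ hδ
  obtain ⟨C, hC0, hC⟩ := exists_toReal_compl_highPaths_le hlam hP hQ
  have hlim : Tendsto (fun b : ℕ => 1 - C * (b : ℝ) ^ (-δ)) atTop (nhds 1) := by
    simpa using (((tendsto_rpow_neg_atTop hδ).comp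
      tendsto_natCast_atTop_atTop).const_mul C).const_sub 1
  refine tendsto_of_tendsto_of_tendsto_of_le_of_le' hlim tendsto_const_nhds ?_ ?_
  · filter_upwards [eventually_gt_atTop 0] with b hb
    have := hQ.1 b
    have hb' : (0 : ℝ) < b := by exact_mod_cast hb
    set N := Nat.floor ((b : ℝ) ^ ((2 : ℝ) - δ))
    have hN : (N : ℝ) / (b : ℝ) ^ 2 ≤ (b : ℝ) ^ (-δ) := by
      rw [div_le_iff₀ (by positivity), ← Real.rpow_natCast, ← Real.rpow_add hb']
      refine (Nat.floor_le (by positivity)).trans_eq ?_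
      congr 1
      push_cast
      ring
    have hcompl := prob_compl_eq_one_sub (μ := Q b) (measurableSet_highPaths b N).compl
    rw [compl_compl] at hcompl
    change _ ≤ (Q b (highPaths b N)).toReal
    rw [hcompl, ENNReal.toReal_sub_of_le prob_le_one ENNReal.one_ne_top, ENNReal.toReal_one]
    have := hC b hb N
    have := mul_le_mul_of_nonneg_left hN hC0
    linarith
  · refine Eventually.of_forall fun b => ?_
    have := hQ.1 b
    exact ENNReal.toReal_le_of_le_ofReal zero_le_one (by simpa using prob_le_one)
end
end

section
/- Let X : ℕ → ℤ be a sequence such that every integer is visited infinitely often (so all the stopping times τ_{k,m} are finite). Then for any integers j ≠ k and any m ≥ 0, L(τ_{k,m}, j) = min{ ℓ ≥ 0 : L(τ_{j,ℓ}, k) ≥ m + 1 }. -/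
noncomputable section

/-- The local time of the sequence `X` at site `k` up to time `n` (inclusively). -/
def locTime (X : ℕ → ℤ) (n : ℕ) (k : ℤ) : ℕ :=
  ((Finset.range (n + 1)).filter fun i => X i = k).card

/-- The inverse local time `τ_{k,m}`: the time of the `(m+1)`-th visit of `X` to `k`. -/
def invLocTime (X : ℕ → ℤ) (k : ℤ) (m : ℕ) : ℕ :=
  sInf {n | m < locTime X n k}

theorem locTime_zero (X : ℕ → ℤ) (k : ℤ) : locTime X 0 k = if X 0 = k then 1 else 0 := by
  rw [locTime, Finset.card_filter, zero_add, Finset.sum_range_one]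

theorem locTime_succ (X : ℕ → ℤ) (n : ℕ) (k : ℤ) :
    locTime X (n + 1) k = locTime X n k + if X (n + 1) = k then 1 else 0 := by
  simp only [locTime, Finset.card_filter]
  rw [Finset.sum_range_succ]

theorem locTime_mono (X : ℕ → ℤ) (k : ℤ) : Monotone fun n => locTime X n k :=
  monotone_nat_of_le_succ fun n => by simp [locTime_succ]

theorem exists_lt_locTime {X : ℕ → ℤ} {k : ℤ} (hX : ∀ N : ℕ, ∃ n ≥ N, X n = k) (m : ℕ) :
    ∃ n, m < locTime X n k := by
  induction m with
  | zero =>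
    obtain ⟨n, -, hn⟩ := hX 0
    exact ⟨n, Finset.card_pos.mpr ⟨n, by simp [hn]⟩⟩
  | succ m ih =>
    obtain ⟨N, hN⟩ := ih
    obtain ⟨n, hn, hXn⟩ := hX (N + 1)
    obtain ⟨p, rfl⟩ : ∃ p, n = p + 1 := ⟨n - 1, by omega⟩
    have hmono : locTime X N k ≤ locTime X p k := locTime_mono X k (by omega)
    refine ⟨p + 1, ?_⟩
    rw [locTime_succ, if_pos hXn]
    omega

theorem lt_locTime_iff {X : ℕ → ℤ} {k : ℤ} (hX : ∀ N : ℕ, ∃ n ≥ N, X n = k) (m n : ℕ) :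
    m < locTime X n k ↔ invLocTime X k m ≤ n :=
  ⟨fun h => Nat.sInf_le h, fun h =>
    (Nat.sInf_mem (s := {n | m < locTime X n k}) (exists_lt_locTime hX m)).trans_le
      (locTime_mono X k h)⟩

theorem apply_invLocTime {X : ℕ → ℤ} {k : ℤ} (hX : ∀ N : ℕ, ∃ n ≥ N, X n = k) (m : ℕ) :
    X (invLocTime X k m) = k := by
  by_contra hne
  have hlt := (lt_locTime_iff hX m _).mpr le_rfl
  rcases ht : invLocTime X k m with _ | s
  · rw [ht] at hne hlt
    simp [locTime_zero, hne] at hlt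
  · rw [ht] at hne hlt
    rw [locTime_succ, if_neg hne, add_zero, lt_locTime_iff hX] at hlt
    omega

/-- Discrete duality between forward and backward local-time curves:
`L(τ_{k,m}, j) = min{ℓ ≥ 0 : L(τ_{j,ℓ}, k) ≥ m+1}`. -/
theorem locTime_invLocTime_duality (X : ℕ → ℤ)
    (hX : ∀ k : ℤ, ∀ N : ℕ, ∃ n ≥ N, X n = k)
    (j k : ℤ) (hjk : j ≠ k) (m : ℕ) :
    locTime X (invLocTime X k m) j =
      sInf {ℓ : ℕ | m + 1 ≤ locTime X (invLocTime X j ℓ) k} := by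
  have hset : {ℓ : ℕ | m + 1 ≤ locTime X (invLocTime X j ℓ) k} =
      Set.Ici (locTime X (invLocTime X k m) j) := by
    ext ℓ
    have hne : invLocTime X k m ≠ invLocTime X j ℓ := fun h =>
      hjk (by rw [← apply_invLocTime (hX j) ℓ, ← h, apply_invLocTime (hX k) m])
    rw [Set.mem_ofPred_eq, Set.mem_Ici, Nat.succ_le_iff, lt_locTime_iff (hX k), ← not_lt,
      ← not_lt, lt_locTime_iff (hX j), not_lt, not_le]
    exact ⟨fun h => h.lt_of_ne hne, le_of_lt⟩
  rw [hset, csInf_Ici]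
end
end

section
/- Let X : ℕ → ℤ be a nearest-neighbor sequence, i.e. |X_{i+1} − X_i| = 1 for all i, with X₀ = 0. Then for every n ∈ ℕ and k ∈ ℤ, L(n,k) = 𝓔⁺_n(k) + 𝓔⁺_n(k−1) − 1{X₀ < k < X_n} + 1{X_n ≤ k ≤ X₀}. -/
noncomputable section

/-- The directed edge local time `𝓔⁺_n(k)`: number of crossings of `k → k+1` before time `n`. -/
def edgePlus (X : ℕ → ℤ) (n : ℕ) (k : ℤ) : ℕ :=
  ((Finset.range n).filter fun i => X i = k ∧ X (i + 1) = k + 1).card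

theorem edgePlus_zero (X : ℕ → ℤ) (k : ℤ) : edgePlus X 0 k = 0 := by
  simp [edgePlus]

theorem edgePlus_succ (X : ℕ → ℤ) (n : ℕ) (k : ℤ) :
    edgePlus X (n + 1) k =
      edgePlus X n k + if X n = k ∧ X (n + 1) = k + 1 then 1 else 0 := by
  simp only [edgePlus, Finset.card_filter]
  rw [Finset.sum_range_succ]

/-- Relation between site local times and directed edge local times for a
nearest-neighbor path started at the origin. -/
theorem locTime_eq_edgePlus (X : ℕ → ℤ) (hnn : ∀ i, |X (i + 1) - X i| = 1)
    (h0 : X 0 = 0) :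
    ∀ (n : ℕ) (k : ℤ),
      (locTime X n k : ℤ) =
        (edgePlus X n k : ℤ) + (edgePlus X n (k - 1) : ℤ)
          - (if X 0 < k ∧ k < X n then 1 else 0)
          + (if X n ≤ k ∧ k ≤ X 0 then 1 else 0) := by
  intro n k
  induction n with
  | zero =>
    rw [locTime_zero, edgePlus_zero, edgePlus_zero]
    push_cast
    split_ifs <;> omega
  | succ n ih =>
    rw [locTime_succ, edgePlus_succ, edgePlus_succ]
    push_cast
    rw [ih]
    rcases (abs_eq zero_le_one).mp (hnn n) with h | h <;> split_ifs <;> omega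
end
end
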